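/- Every even binary word W can be cut into at most three consecutive blocks which can be rearranged (permuted and concatenated) to form a reverse shuffle square; that is, there exists a factorization W = B_1 B_2 B_3 into (possibly empty) blocks and a permutation π of {1,2,3} such that B_{π(1)} B_{π(2)} B_{π(3)} is a reverse shuffle square. -/

import Mathlib

/-- `Interleave x y z` means that `z` is an interleaving (shuffle) of the words
`x` and `y`. -/
inductive Interleave {α : Type*} : List α → List α → List α → Prop
  | nil : Interleave [] [] []
  | cons_left (a : α) {xs ys zs : List α} :
      Interleave xs ys zs → Interleave (a :: xs) ys (a :: zs)
  | cons_right (a : α) {xs ys zs : List α} :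
      Interleave xs ys zs → Interleave xs (a :: ys) (a :: zs)

/-- A word is a reverse shuffle square if it is an interleaving of a word `x` and the
reverse of `x`. -/
def IsRevShuffleSquare {α : Type*} (w : List α) : Prop :=
  ∃ x : List α, Interleave x x.reverse w

theorem Interleave.append {α : Type*} {x y z x' y' z' : List α} (h : Interleave x y z)
    (h' : Interleave x' y' z') : Interleave (x ++ x') (y ++ y') (z ++ z') := by
  induction h with
  | nil => exact h'
  | cons_left a _ ih => exact ih.cons_left a
  | cons_right a _ ih => exact ih.cons_right a

theorem interleave_replicate_count (b : Bool) (u : List Bool) :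
    Interleave (List.replicate (u.count b) b) (List.replicate (u.count !b) !b) u := by
  induction u with
  | nil => exact .nil
  | cons a u ih =>
    obtain rfl | rfl : a = b ∨ a = !b := by cases a <;> cases b <;> simp
    · simpa [List.replicate_succ] using ih.cons_left a
    · simpa [List.replicate_succ] using ih.cons_right (!b)

/-- Every binary abelian square is a reverse shuffle square. -/
theorem isRevShuffleSquare_append {u v : List Bool} (h : ∀ b, u.count b = v.count b) :
    IsRevShuffleSquare (u ++ v) := by
  refine ⟨List.replicate (u.count false) false ++ List.replicate (u.count true) true, ?_⟩
  have hu := interleave_replicate_count false u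
  have hv := interleave_replicate_count true v
  rw [← h, ← h] at hv
  simpa using hu.append hv

theorem exists_le_eq_zero_of_le_add_one {f : ℕ → ℤ} {n : ℕ} (hf : ∀ i, f (i + 1) ≤ f i + 1)
    (h0 : f 0 ≤ 0) (hn : 0 ≤ f n) : ∃ i ≤ n, f i = 0 := by
  induction n with
  | zero => exact ⟨0, le_rfl, le_antisymm h0 hn⟩
  | succ n ih =>
    by_cases h : 0 ≤ f n
    · obtain ⟨i, hi, hfi⟩ := ih h
      exact ⟨i, hi.trans n.le_succ, hfi⟩
    · exact ⟨n + 1, le_rfl, by have := hf n; omega⟩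

theorem exists_le_eq_zero_of_abs_sub_le_one {f : ℕ → ℤ} {n : ℕ}
    (hf : ∀ i, |f (i + 1) - f i| ≤ 1) (h : f n = -f 0) : ∃ i ≤ n, f i = 0 := by
  rcases le_total (f 0) 0 with h0 | h0
  · exact exists_le_eq_zero_of_le_add_one
      (fun i => by linarith [(abs_le.mp (hf i)).2]) h0 (by omega)
  · obtain ⟨i, hi, hfi⟩ := exists_le_eq_zero_of_le_add_one (f := fun i => -f i) (n := n)
      (fun i => by linarith [(abs_le.mp (hf i)).1]) (by simpa using h0) (by omega)
    exact ⟨i, hi, neg_eq_zero.mp hfi⟩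

theorem count_take_succ_bounds {α : Type*} [DecidableEq α] (a : α) (w : List α) (i : ℕ) :
    (w.take i).count a ≤ (w.take (i + 1)).count a ∧
      (w.take (i + 1)).count a ≤ (w.take i).count a + 1 := by
  rw [List.take_add_one, List.count_append]
  refine ⟨Nat.le_add_right _ _, Nat.add_le_add_left (List.count_le_length.trans ?_) _⟩
  cases w[i]? <;> simp

/-- Every even binary word can be cut into at most three consecutive blocks which can be
rearranged to form a reverse shuffle square. -/
theorem statement19 (w : List Bool)
    (heven1 : Even (w.count true)) (heven0 : Even (w.count false)) :
    ∃ B : Fin 3 → List Bool, ∃ π : Equiv.Perm (Fin 3),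
      w = B 0 ++ B 1 ++ B 2 ∧
      IsRevShuffleSquare (B (π 0) ++ B (π 1) ++ B (π 2)) := by
  obtain ⟨k, hk⟩ := heven1
  obtain ⟨l, hl⟩ := heven0
  have hlen : w.length = (k + l) + (k + l) := by
    have := List.count_true_add_count_false w
    omega
  set n := k + l with hn
  obtain ⟨i, hi, hfi⟩ := exists_le_eq_zero_of_abs_sub_le_one (n := n)
    (f := fun i => ((w.take (i + n)).count true : ℤ) - (w.take i).count true - k)
    (fun i => by
      have h1 := count_take_succ_bounds true w i
      have h2 := count_take_succ_bounds true w (i + n)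
      rw [Nat.add_right_comm i n 1] at h2
      rw [abs_le]
      constructor <;> omega)
    (by simp [← hlen, hk]; ring)
  have hw : w = w.take i ++ (w.drop i).take n ++ w.drop (i + n) := by
    rw [← List.take_add, List.take_append_drop]
  have hwin : ((w.drop i).take n).count true = k := by
    simp only [List.take_add, List.count_append, Nat.cast_add] at hfi
    omega
  have hwinlen : ((w.drop i).take n).length = n := by
    rw [List.length_take, List.length_drop]
    omega
  refine ⟨![w.take i, (w.drop i).take n, w.drop (i + n)], Equiv.swap 0 1, hw, ?_⟩
  have hperm : (Equiv.swap (0 : Fin 3) 1) 2 = 2 := by decide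
  simp only [Equiv.swap_apply_left, Equiv.swap_apply_right, hperm, List.append_assoc,
    Matrix.cons_val]
  refine isRevShuffleSquare_append fun b => ?_
  have htot := congrArg (List.count b) hw
  have hsum := List.count_true_add_count_false ((w.drop i).take n)
  simp only [List.count_append] at htot ⊢
  cases b <;> omega
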